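/- There exist simple graded subquotients S, T of A^λ with S ≅ T[n] if and only if λ = σⁿ(λ). In particular, if σ acts freely on the maximal ideals of R, then the simple subquotients of A^λ are pairwise nonisomorphic. -/

import Mathlib

noncomputable section

/-- A realization of the generalized Weyl algebra `T(R,σ,v)`:
a `ℤ`-graded `ℂ`-algebra `A` containing `R` in degree `0`, with elements
`t₊` of degree `1` and `t₋` of degree `-1` satisfying the GWA relations, such that each
homogeneous component `A_n` is free of rank one as a left `R`-module with basis
`t₊^n` (for `n ≥ 0`) resp. `t₋^{-n}` (for `n ≤ 0`). -/
structure GWA (R : Type) [CommRing R] [Algebra ℂ R] (σ : R ≃ₐ[ℂ] R) (v : R) : Type 1 where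
  A : Type
  [ringA : Ring A]
  [algA : Algebra ℂ A]
  emb : R →ₐ[ℂ] A
  tp : A
  tm : A
  rel1 : ∀ r : R, emb r * tp = tp * emb (σ r)
  rel2 : ∀ r : R, emb (σ r) * tm = tm * emb r
  rel3 : tm * tp = emb (σ v)
  rel4 : tp * tm = emb v
  deg : ℤ → AddSubgroup A
  algmap_mem : ∀ c : ℂ, algebraMap ℂ A c ∈ deg 0
  emb_mem : ∀ r : R, emb r ∈ deg 0
  tp_mem : tp ∈ deg 1
  tm_mem : tm ∈ deg (-1)
  mul_mem : ∀ {i j : ℤ} {a b : A}, a ∈ deg i → b ∈ deg j → a * b ∈ deg (i + j)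
  decomp : ∀ a : A, ∃ (s : Finset ℤ) (g : ℤ → A), (∀ i, g i ∈ deg i) ∧ a = ∑ i ∈ s, g i
  indep : ∀ (s : Finset ℤ) (g : ℤ → A), (∀ i, g i ∈ deg i) → (∑ i ∈ s, g i) = 0 →
    ∀ i ∈ s, g i = 0
  free_pos : ∀ n : ℕ, ∀ a ∈ deg (n : ℤ), ∃! r : R, a = emb r * tp ^ n
  free_neg : ∀ n : ℕ, ∀ a ∈ deg (-(n : ℤ)), ∃! r : R, a = emb r * tm ^ n

attribute [instance] GWA.ringA GWA.algA

variable {R : Type} [CommRing R] [Algebra ℂ R] {σ : R ≃ₐ[ℂ] R} {v : R}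

/-- A `ℤ`-graded left module over (a realization of) a generalized Weyl algebra. -/
structure GradedMod (G : GWA R σ v) : Type 1 where
  M : Type
  [acg : AddCommGroup M]
  [mod : Module G.A M]
  deg : ℤ → AddSubgroup M
  smul_mem : ∀ {i j : ℤ} {a : G.A} {m : M}, a ∈ G.deg i → m ∈ deg j → a • m ∈ deg (i + j)
  decomp : ∀ m : M, ∃ (s : Finset ℤ) (g : ℤ → M), (∀ i, g i ∈ deg i) ∧ m = ∑ i ∈ s, g i
  indep : ∀ (s : Finset ℤ) (g : ℤ → M), (∀ i, g i ∈ deg i) → (∑ i ∈ s, g i) = 0 →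
    ∀ i ∈ s, g i = 0

attribute [instance] GradedMod.acg GradedMod.mod

variable {G : GWA R σ v}

/-- A homomorphism of graded modules that shifts degrees by `n`, i.e. an element of
`Hom_gr(X, Y[n])`. -/
structure GHom (X Y : GradedMod G) (n : ℤ) : Type where
  toLin : X.M →ₗ[G.A] Y.M
  map_deg : ∀ i : ℤ, ∀ m ∈ X.deg i, toLin m ∈ Y.deg (i + n)

/-- `X` is isomorphic to `Y[n]` as a graded module. -/
def GIso (X Y : GradedMod G) (n : ℤ) : Prop :=
  ∃ f : GHom X Y n, Function.Bijective f.toLin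

/-- A submodule is graded if every element of it is a sum of homogeneous elements of it. -/
def IsGradedSub (X : GradedMod G) (N : Submodule G.A X.M) : Prop :=
  ∀ m ∈ N, ∃ (s : Finset ℤ) (g : ℤ → X.M),
    (∀ i, g i ∈ X.deg i) ∧ (∀ i, g i ∈ N) ∧ m = ∑ i ∈ s, g i

/-- `χ_λ = {k ∈ ℤ : σ^k(v) ∈ λ}`. -/
def chiSet (σ : R ≃ₐ[ℂ] R) (v : R) (lam : Ideal R) : Set ℤ := {k : ℤ | (σ ^ k) v ∈ lam}

/-- `X` is (a realization of) the graded module `A^λ = A/Aλ`: it is cyclic, generated by a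
degree-zero element whose annihilator is the left ideal generated by `λ`. -/
def IsStdMod (G : GWA R σ v) (lam : Ideal R) (X : GradedMod G) : Prop :=
  ∃ x ∈ X.deg 0, Submodule.span G.A {x} = ⊤ ∧
    ∀ a : G.A, a • x = 0 ↔ a ∈ Submodule.span G.A (G.emb '' (lam : Set R))

/-- A graded module is simple if it is nonzero and has no proper nontrivial graded submodules. -/
def IsSimpleGr (X : GradedMod G) : Prop :=
  (∃ m : X.M, m ≠ 0) ∧ ∀ N : Submodule G.A X.M, IsGradedSub X N → N = ⊥ ∨ N = ⊤

/-- Artinian graded module : the descending chain condition on graded submodules. -/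
def IsArtinianGr (X : GradedMod G) : Prop :=
  ∀ f : ℕ → Submodule G.A X.M, (∀ n, IsGradedSub X (f n)) →
    (∀ n, f (n + 1) ≤ f n) → ∃ n, ∀ m, n ≤ m → f m = f n

/-- `Y` is a graded subquotient of `X`. -/
def IsSubquotient (X Y : GradedMod G) : Prop :=
  ∃ (Q P : Submodule G.A X.M), IsGradedSub X Q ∧ IsGradedSub X P ∧ P ≤ Q ∧
    ∃ φ : Q →ₗ[G.A] Y.M, Function.Surjective φ ∧
      (∀ q : Q, φ q = 0 ↔ (q : X.M) ∈ P) ∧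
      (∀ (i : ℤ) (q : Q), (q : X.M) ∈ X.deg i → φ q ∈ Y.deg i)


section Helpers

theorem exists_proj {M : Type} [AddCommGroup M] (deg : ℤ → AddSubgroup M)
    (decomp : ∀ m : M, ∃ (s : Finset ℤ) (g : ℤ → M), (∀ i, g i ∈ deg i) ∧ m = ∑ i ∈ s, g i)
    (indep : ∀ (s : Finset ℤ) (g : ℤ → M), (∀ i, g i ∈ deg i) → (∑ i ∈ s, g i) = 0 →
      ∀ i ∈ s, g i = 0) :
    ∃ p : ℤ → M →+ M, (∀ i m, p i m ∈ deg i) ∧ (∀ i m, m ∈ deg i → p i m = m) ∧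
      (∀ i j m, m ∈ deg i → i ≠ j → p j m = 0) ∧ (∀ m, ∃ s : Finset ℤ, m = ∑ i ∈ s, p i m) := by
  classical
  have hint : DirectSum.IsInternal deg := by
    constructor
    · rw [injective_iff_map_eq_zero]
      intro a ha
      rw [DirectSum.coeAddMonoidHom_eq_dfinsuppSum] at ha
      ext i
      by_cases hi : i ∈ DFinsupp.support a
      · exact indep (DFinsupp.support a) (fun i => (a i : M)) (fun i => (a i).2) ha i hi
      · have : a i = 0 := by simpa using hi
        simp [this]
    · intro m
      obtain ⟨s, g, hg, rfl⟩ := decomp m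
      refine ⟨∑ i ∈ s, DirectSum.of (fun i => deg i) i ⟨g i, hg i⟩, ?_⟩
      simp [map_sum]
  letI : DirectSum.Decomposition deg := hint.chooseDecomposition
  refine ⟨fun i => ((deg i).subtype.comp (DFinsupp.evalAddMonoidHom i)).comp
    (DirectSum.decomposeAddEquiv deg).toAddMonoidHom, ?_, ?_, ?_, ?_⟩
  · intro i m
    exact ((DirectSum.decompose deg m) i).2
  · intro i m hm
    exact DirectSum.decompose_of_mem_same deg hm
  · intro i j m hm hij
    exact DirectSum.decompose_of_mem_ne deg hm hij
  · intro m
    exact ⟨_, (DirectSum.sum_support_decompose deg m).symm⟩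

variable {R : Type} [CommRing R] [Algebra ℂ R] {σ : R ≃ₐ[ℂ] R} {v : R} {G : GWA R σ v}

def GradedMod.p (X : GradedMod G) : ℤ → X.M →+ X.M :=
  (exists_proj X.deg X.decomp X.indep).choose

theorem GradedMod.p_mem (X : GradedMod G) (i : ℤ) (m : X.M) : X.p i m ∈ X.deg i :=
  (exists_proj X.deg X.decomp X.indep).choose_spec.1 i m

theorem GradedMod.p_same (X : GradedMod G) {i : ℤ} {m : X.M} (h : m ∈ X.deg i) : X.p i m = m :=
  (exists_proj X.deg X.decomp X.indep).choose_spec.2.1 i m h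

theorem GradedMod.p_ne (X : GradedMod G) {i j : ℤ} {m : X.M} (h : m ∈ X.deg i) (hij : i ≠ j) :
    X.p j m = 0 :=
  (exists_proj X.deg X.decomp X.indep).choose_spec.2.2.1 i j m h hij

theorem GradedMod.p_sum (X : GradedMod G) (m : X.M) :
    ∃ s : Finset ℤ, m = ∑ i ∈ s, X.p i m :=
  (exists_proj X.deg X.decomp X.indep).choose_spec.2.2.2 m

theorem GradedMod.hom_induction (X : GradedMod G) {P : X.M → Prop} (h0 : P 0)
    (hadd : ∀ a b, P a → P b → P (a + b)) (h : ∀ i, ∀ m ∈ X.deg i, P m) (m : X.M) : P m := by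
  obtain ⟨s, hs⟩ := X.p_sum m
  rw [hs]
  exact Finset.sum_induction _ P hadd h0 (fun i _ => h i _ (X.p_mem i m))

/-- The regular graded module. -/
def regMod (G : GWA R σ v) : GradedMod G where
  M := G.A
  deg := G.deg
  smul_mem := fun ha hm => G.mul_mem ha hm
  decomp := G.decomp
  indep := G.indep

/-- Projections of the algebra. -/
def GWA.p (G : GWA R σ v) : ℤ → G.A →+ G.A := (regMod G).p

theorem GWA.p_mem (G : GWA R σ v) (i : ℤ) (m : G.A) : G.p i m ∈ G.deg i := (regMod G).p_mem i m

theorem GWA.p_same (G : GWA R σ v) {i : ℤ} {m : G.A} (h : m ∈ G.deg i) : G.p i m = m :=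
  (regMod G).p_same h

theorem GWA.p_ne (G : GWA R σ v) {i j : ℤ} {m : G.A} (h : m ∈ G.deg i) (hij : i ≠ j) :
    G.p j m = 0 := (regMod G).p_ne h hij

theorem GWA.p_sum (G : GWA R σ v) (m : G.A) :
    ∃ s : Finset ℤ, m = ∑ i ∈ s, G.p i m := (regMod G).p_sum m

theorem GWA.hom_induction (G : GWA R σ v) {P : G.A → Prop} (h0 : P 0)
    (hadd : ∀ a b, P a → P b → P (a + b)) (h : ∀ i, ∀ m ∈ G.deg i, P m) (m : G.A) : P m :=
  (regMod G).hom_induction h0 hadd h m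

theorem p_smul_left (X : GradedMod G) {i : ℤ} {a : G.A} (ha : a ∈ G.deg i) (j : ℤ) (m : X.M) :
    X.p j (a • m) = a • X.p (j - i) m := by
  induction m using X.hom_induction with
  | h0 => simp
  | hadd x y hx hy => simp [hx, hy]
  | h k m hm =>
    by_cases hk : k = j - i
    · subst hk
      rw [X.p_same hm]
      apply X.p_same
      have := X.smul_mem ha hm
      rwa [add_sub_cancel] at this
    · rw [X.p_ne hm hk, X.p_ne (X.smul_mem ha hm) (by omega), smul_zero]

theorem p_smul_right (X : GradedMod G) {i : ℤ} {m : X.M} (hm : m ∈ X.deg i) (j : ℤ) (a : G.A) :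
    X.p j (a • m) = G.p (j - i) a • m := by
  induction a using G.hom_induction with
  | h0 => simp
  | hadd x y hx hy => simp [hx, hy, add_smul]
  | h k a ha =>
    by_cases hk : k = j - i
    · subst hk
      rw [G.p_same ha]
      apply X.p_same
      have := X.smul_mem ha hm
      rwa [sub_add_cancel] at this
    · rw [G.p_ne ha hk, X.p_ne (X.smul_mem ha hm) (by omega), zero_smul]

theorem p_mul_left (G : GWA R σ v) {i : ℤ} {a : G.A} (ha : a ∈ G.deg i) (j : ℤ) (m : G.A) :
    G.p j (a * m) = a * G.p (j - i) m := p_smul_left (regMod G) ha j m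

theorem p_mul_right (G : GWA R σ v) {i : ℤ} {m : G.A} (hm : m ∈ G.deg i) (j : ℤ) (a : G.A) :
    G.p j (a * m) = G.p (j - i) a * m := p_smul_right (regMod G) hm j a

theorem one_mem_deg (G : GWA R σ v) : (1 : G.A) ∈ G.deg 0 := by
  simpa using G.emb_mem 1

theorem exists_emb {a : G.A} (ha : a ∈ G.deg 0) : ∃ r : R, a = G.emb r := by
  obtain ⟨r, hr, -⟩ := G.free_pos 0 a (by simpa using ha)
  exact ⟨r, by simpa using hr⟩

theorem emb_inj {r s : R} (h : G.emb r = G.emb s) : r = s := by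
  obtain ⟨t, -, ht⟩ := G.free_pos 0 (G.emb r) (by simpa using G.emb_mem r)
  rw [ht r (by simp), ht s (by simp [h])]

theorem exists_t (G : GWA R σ v) (n : ℤ) : ∃ t ∈ G.deg n,
    (∀ r, G.emb r * t = t * G.emb ((σ ^ n) r)) ∧ (∀ a ∈ G.deg n, ∃! r, a = G.emb r * t) := by
  obtain ⟨k, rfl | rfl⟩ := n.eq_nat_or_neg
  · refine ⟨G.tp ^ k, ?_, ?_, G.free_pos k⟩
    · induction k with
      | zero => simpa using one_mem_deg G
      | succ k ih => 
        rw [pow_succ]; push_cast; exact G.mul_mem ih G.tp_mem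
    · induction k with
      | zero => simp
      | succ k ih =>
        intro r
        rw [pow_succ, ← mul_assoc, ih, mul_assoc, G.rel1, mul_assoc]
        congr 3
        push_cast
        rw [add_comm, zpow_one_add, AlgEquiv.mul_apply]
  · refine ⟨G.tm ^ k, ?_, ?_, G.free_neg k⟩
    · induction k with
      | zero => simpa using one_mem_deg G
      | succ k ih => 
        rw [pow_succ]; push_cast; rw [neg_add]; exact G.mul_mem ih G.tm_mem
    · induction k with
      | zero => simp
      | succ k ih =>
        intro r
        have h2 : ∀ r, G.emb r * G.tm = G.tm * G.emb (σ⁻¹ r) := by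
          intro r
          have := G.rel2 (σ⁻¹ r)
          rwa [← AlgEquiv.mul_apply, mul_inv_cancel, AlgEquiv.one_apply] at this
        rw [pow_succ, ← mul_assoc, ih, mul_assoc, h2, mul_assoc]
        congr 3
        rw [← AlgEquiv.mul_apply]
        congr 1
        push_cast
        rw [neg_add, add_comm, zpow_add, zpow_neg_one]

/-- The maximal graded left ideal meeting degree zero in `mu`. -/
def maxI (G : GWA R σ v) (mu : Ideal R) : Submodule G.A G.A where
  carrier := {a | ∀ c, ∃ r ∈ mu, G.p 0 (c * a) = G.emb r}
  zero_mem' := fun c => ⟨0, mu.zero_mem, by simp⟩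
  add_mem' := by
    intro a b ha hb c
    obtain ⟨r, hr, h⟩ := ha c
    obtain ⟨s, hs, h'⟩ := hb c
    exact ⟨r + s, mu.add_mem hr hs, by rw [mul_add, map_add, map_add, h, h']⟩
  smul_mem' := by
    intro d a ha c
    obtain ⟨r, hr, h⟩ := ha (c * d)
    exact ⟨r, hr, by rw [smul_eq_mul, ← mul_assoc, h]⟩

theorem mem_maxI {mu : Ideal R} {a : G.A} :
    a ∈ maxI G mu ↔ ∀ c, ∃ r ∈ mu, G.p 0 (c * a) = G.emb r := Iff.rfl

theorem p_mem_maxI {mu : Ideal R} {a : G.A} (ha : a ∈ maxI G mu) (k : ℤ) :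
    G.p k a ∈ maxI G mu := by
  intro c
  obtain ⟨r, hr, h⟩ := ha (G.p (0 - k) c)
  refine ⟨r, hr, ?_⟩
  rw [← h, p_mul_right G (G.p_mem k a), p_mul_left G (G.p_mem (0 - k) c),
    sub_sub_cancel]

theorem emb_mem_maxI {mu : Ideal R} {r : R} (hr : r ∈ mu) : G.emb r ∈ maxI G mu := by
  intro c
  rw [p_mul_right G (G.emb_mem r)]
  obtain ⟨s, hs⟩ := exists_emb (G.p_mem (0 - 0) c)
  exact ⟨s * r, mu.mul_mem_left _ hr, by rw [hs, map_mul]⟩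

/-- The simple module `A / maxI`, shifted by `d`. -/
def simpleMod (G : GWA R σ v) (mu : Ideal R) (d : ℤ) : GradedMod G where
  M := G.A ⧸ maxI G mu
  deg := fun j => (G.deg (j - d)).map (maxI G mu).mkQ.toAddMonoidHom
  smul_mem := by
    rintro i j a _ ha ⟨b, hb, rfl⟩
    refine ⟨a * b, ?_, rfl⟩
    have := G.mul_mem ha hb
    rwa [← add_sub_assoc] at this
  decomp := by
    intro m
    obtain ⟨a, rfl⟩ := (maxI G mu).mkQ_surjective m
    obtain ⟨s, hs⟩ := G.p_sum a
    refine ⟨s.image (· + d), fun j => (maxI G mu).mkQ (G.p (j - d) a),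
      fun j => ⟨_, G.p_mem _ _, rfl⟩, ?_⟩
    rw [Finset.sum_image (by simp)]
    simp only [add_sub_cancel_right]
    rw [← map_sum, ← hs]
  indep := by
    intro s g hg h i hi
    choose b hb hbg using hg
    have hbg' : ∀ i, (maxI G mu).mkQ (b i) = g i := hbg
    simp only [← hbg'] at h ⊢
    rw [← map_sum] at h
    simp only [Submodule.mkQ_apply, Submodule.Quotient.mk_eq_zero] at h ⊢
    have := p_mem_maxI h (i - d)
    rw [map_sum, Finset.sum_eq_single i, G.p_same (hb i)] at this
    · exact this
    · intro j _ hj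
      exact G.p_ne (hb j) (by omega)
    · intro h; exact absurd hi h

theorem simpleMod_simple (G : GWA R σ v) (mu : Ideal R) (hmu : mu.IsMaximal) (d : ℤ) :
    IsSimpleGr (simpleMod G mu d) := by
  constructor
  · refine ⟨(maxI G mu).mkQ 1, ?_⟩
    intro h
    have h' : (1 : G.A) ∈ maxI G mu := (Submodule.Quotient.mk_eq_zero _).1 h
    obtain ⟨r, hr, h⟩ := h' 1
    rw [mul_one, G.p_same (one_mem_deg G), ← map_one G.emb] at h
    rw [← emb_inj h] at hr
    exact hmu.ne_top ((Ideal.eq_top_iff_one _).2 hr)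
  · intro N hN
    by_cases hbot : N = ⊥
    · exact Or.inl hbot
    right
    obtain ⟨m, hm, hm0⟩ := N.ne_bot_iff.1 hbot
    obtain ⟨s, g, hg, hgN, rfl⟩ := hN m hm
    obtain ⟨i, hi, hgi⟩ := Finset.exists_ne_zero_of_sum_ne_zero hm0
    obtain ⟨a, ha, hag⟩ := hg i
    have hag' : (maxI G mu).mkQ a = g i := hag
    have haI : a ∉ maxI G mu := by
      intro h
      apply hgi
      rw [← hag']
      exact (Submodule.Quotient.mk_eq_zero _).2 h
    rw [mem_maxI] at haI
    push Not at haI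
    obtain ⟨c, hc⟩ := haI
    rw [p_mul_right G ha] at hc
    set c' := G.p (0 - (i - d)) c with hc'
    have hdeg : c' * a ∈ G.deg 0 := by
      have := G.mul_mem (G.p_mem (0 - (i - d)) c) ha
      rwa [sub_add_cancel] at this
    obtain ⟨r, hr⟩ := exists_emb hdeg
    have hrmu : r ∉ mu := fun h => hc r h hr
    obtain ⟨r', hr'⟩ := hmu.exists_inv hrmu
    obtain ⟨l, hl, hrl⟩ := hr'
    have key : (maxI G mu).mkQ 1 ∈ N := by
      have h1 : (G.emb r' * c') • g i ∈ N := N.smul_mem _ (hgN i)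
      rw [← hag'] at h1
      have h2 : (maxI G mu).mkQ 1 = (G.emb r' * c') • (maxI G mu).mkQ a := by
        rw [← map_smul, ← sub_eq_zero, ← map_sub]
        refine (Submodule.Quotient.mk_eq_zero _).2 ?_
        rw [smul_eq_mul, mul_assoc, hr, ← map_mul, ← map_one G.emb, ← map_sub, ← hrl]
        apply emb_mem_maxI
        simpa using hl
      exact h2 ▸ h1
    rw [eq_top_iff]
    intro m _
    obtain ⟨b, rfl⟩ := (maxI G mu).mkQ_surjective m
    have := N.smul_mem b key
    have e : (maxI G mu).mkQ b = b • (maxI G mu).mkQ 1 := by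
      rw [← map_smul, smul_eq_mul, mul_one]
    exact e ▸ this

theorem isGradedSub_of_p (X : GradedMod G) (N : Submodule G.A X.M)
    (h : ∀ m ∈ N, ∀ i, X.p i m ∈ N) : IsGradedSub X N := by
  intro m hm
  obtain ⟨s, hs⟩ := X.p_sum m
  exact ⟨s, fun i => X.p i m, fun i => X.p_mem i m, h m hm, hs⟩

theorem simpleMod_subquotient (X : GradedMod G) (mu : Ideal R) (d : ℤ) (y : X.M)
    (hy : y ∈ X.deg d) (hann : ∀ r, G.emb r • y = 0 → r ∈ mu) :
    IsSubquotient X (simpleMod G mu d) := by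
  let f : G.A →ₗ[G.A] X.M := LinearMap.toSpanSingleton G.A X.M y
  have hf : ∀ a, f a = a • y := fun a => rfl
  have hker : LinearMap.ker f ≤ maxI G mu := by
    intro a ha c
    have ha' : a • y = 0 := ha
    obtain ⟨r, hr⟩ := exists_emb (G.p_mem 0 (c * a))
    refine ⟨r, hann r ?_, hr⟩
    rw [← hr]
    have := p_smul_right X hy d (c * a)
    rw [sub_self] at this
    rw [← this, mul_smul, ha', smul_zero, map_zero]
  have hp : ∀ i a, X.p i (f a) = f (G.p (i - d) a) := fun i a => p_smul_right X hy i a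
  let φ : LinearMap.range f →ₗ[G.A] (G.A ⧸ maxI G mu) :=
    (Submodule.factor hker).comp f.quotKerEquivRange.symm.toLinearMap
  have hφ : ∀ a (h : f a ∈ LinearMap.range f), φ ⟨f a, h⟩ = (maxI G mu).mkQ a := by
    intro a h
    have : f.quotKerEquivRange.symm ⟨f a, h⟩ = (LinearMap.ker f).mkQ a :=
      f.quotKerEquivRange_symm_apply_image a h
    change Submodule.factor hker (f.quotKerEquivRange.symm ⟨f a, h⟩) = _
    rw [this]
    rfl
  refine ⟨LinearMap.range f, (maxI G mu).map f, ?_, ?_, ?_, φ, ?_, ?_, ?_⟩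
  · apply isGradedSub_of_p
    rintro _ ⟨a, rfl⟩ i
    rw [hp]
    exact ⟨_, rfl⟩
  · apply isGradedSub_of_p
    rintro _ ⟨a, ha, rfl⟩ i
    rw [hp]
    exact ⟨_, p_mem_maxI ha _, rfl⟩
  · rintro _ ⟨a, ha, rfl⟩
    exact ⟨_, rfl⟩
  · intro m
    obtain ⟨a, rfl⟩ := (maxI G mu).mkQ_surjective m
    exact ⟨⟨f a, a, rfl⟩, hφ a _⟩
  · rintro ⟨_, a, rfl⟩
    have e := hφ a ⟨a, rfl⟩
    constructor
    · intro h
      have h' : (maxI G mu).mkQ a = 0 := e.symm.trans h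
      exact ⟨a, (Submodule.Quotient.mk_eq_zero _).1 h', rfl⟩
    · rintro ⟨b, hb, hba⟩
      refine e.trans ((Submodule.Quotient.mk_eq_zero _).2 ?_)
      have : a - b ∈ LinearMap.ker f := by
        rw [LinearMap.mem_ker, map_sub, hba, sub_self]
      have := (maxI G mu).add_mem (hker this) hb
      rwa [sub_add_cancel] at this
  · rintro i ⟨_, a, rfl⟩ hq
    have hq' : f a ∈ X.deg i := hq
    have e : f a = f (G.p (i - d) a) := by rw [← hp, X.p_same hq']
    refine ⟨G.p (i - d) a, G.p_mem _ _, ?_⟩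
    have e2 := hφ (G.p (i - d) a) ⟨_, rfl⟩
    refine e2.symm.trans ?_
    congr 1
    exact Subtype.ext e.symm

theorem map_eq_iff (lam : Ideal R) (τ : R ≃ₐ[ℂ] R) :
    Ideal.map τ.toAlgHom.toRingHom lam = lam ↔ ∀ r, τ r ∈ lam ↔ r ∈ lam := by
  have hmem : ∀ r, τ r ∈ Ideal.map τ.toAlgHom.toRingHom lam ↔ r ∈ lam := by
    intro r
    rw [Ideal.mem_map_iff_of_surjective τ.toAlgHom.toRingHom τ.surjective]
    constructor
    · rintro ⟨s, hs, h⟩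
      have : τ s = τ r := h
      rwa [← τ.injective this]
    · intro h
      exact ⟨r, h, rfl⟩
  constructor
  · intro h r
    rw [← hmem r, h]
  · intro h
    ext s
    obtain ⟨r, rfl⟩ := τ.surjective s
    rw [hmem, h]

theorem t_smul_ne (lam : Ideal R) (hlam : lam.IsMaximal) (n : ℤ) (t : G.A) (ht : t ∈ G.deg n)
    (h1 : ∀ r, G.emb r * t = t * G.emb ((σ ^ n) r))
    (h2 : ∀ a ∈ G.deg n, ∃! r, a = G.emb r * t) :
    t ∉ Submodule.span G.A (G.emb '' (lam : Set R)) := by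
  intro hmem
  have key : ∀ a ∈ Submodule.span G.A (G.emb '' (lam : Set R)),
      ∀ c, ∃ r, (σ ^ n) r ∈ lam ∧ G.p n (c * a) = G.emb r * t := by
    intro a ha
    induction ha using Submodule.span_induction with
    | mem a ha =>
      obtain ⟨l, hl, rfl⟩ := ha
      intro c
      rw [p_mul_right G (G.emb_mem l)]
      obtain ⟨s, hs, -⟩ := h2 _ (sub_zero n ▸ G.p_mem (n - 0) c)
      have hl' : (σ ^ n) ((σ ^ n).symm l) = l := AlgEquiv.apply_symm_apply _ _
      refine ⟨s * (σ ^ n).symm l, ?_, ?_⟩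
      · rw [map_mul, hl']
        exact lam.mul_mem_left _ hl
      · rw [map_mul, mul_assoc, h1, hl', ← mul_assoc, ← hs, sub_zero]
    | zero => exact fun c => ⟨0, by simp, by simp⟩
    | add a b _ _ ha hb =>
      intro c
      obtain ⟨r, hr, h⟩ := ha c
      obtain ⟨s, hs, h'⟩ := hb c
      exact ⟨r + s, by rw [map_add]; exact lam.add_mem hr hs,
        by rw [mul_add, map_add, map_add, add_mul, h, h']⟩
    | smul d a _ ha =>
      intro c
      obtain ⟨r, hr, h⟩ := ha (c * d)
      exact ⟨r, hr, by rw [smul_eq_mul, ← mul_assoc, h]⟩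
  obtain ⟨r, hr, h⟩ := key t hmem 1
  rw [one_mul, G.p_same ht] at h
  have : r = 1 := (h2 t ht).unique h (by simp)
  rw [this, map_one] at hr
  exact hlam.ne_top ((Ideal.eq_top_iff_one _).2 hr)

theorem std_killed (lam : Ideal R) (X : GradedMod G) (hX : IsStdMod G lam X) (i : ℤ) (m : X.M)
    (hm : m ∈ X.deg i) (r : R) (hr : (σ ^ i) r ∈ lam) : G.emb r • m = 0 := by
  obtain ⟨x, hx, hspan, hann⟩ := hX
  obtain ⟨a, rfl⟩ := Submodule.mem_span_singleton.1 (hspan ▸ Submodule.mem_top : m ∈ _)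
  obtain ⟨t, ht, h1, h2⟩ := exists_t G i
  have e : a • x = G.p i a • x := by
    rw [← X.p_same hm, p_smul_right X hx, sub_zero]
  obtain ⟨s, hs, -⟩ := h2 _ (G.p_mem i a)
  have hz : G.emb ((σ ^ i) r) • x = 0 :=
    (hann _).2 (Submodule.subset_span ⟨_, hr, rfl⟩)
  rw [e, hs, ← mul_smul, ← mul_assoc, ← map_mul, mul_comm r s, map_mul, mul_assoc, h1,
    mul_smul, mul_smul, hz, smul_zero, smul_zero]

theorem subq_killed (lam : Ideal R) (X : GradedMod G) (hX : IsStdMod G lam X) (T : GradedMod G)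
    (hT : IsSubquotient X T) (i : ℤ) (m : T.M)
    (hm : m ∈ T.deg i) (r : R) (hr : (σ ^ i) r ∈ lam) : G.emb r • m = 0 := by
  obtain ⟨Q, P, hQ, hP, hPQ, φ, hsurj, hker, hdeg⟩ := hT
  obtain ⟨⟨q, hq⟩, rfl⟩ := hsurj m
  obtain ⟨s, g, hg, hgQ, rfl⟩ := hQ q hq
  have e : φ ⟨_, hq⟩ = ∑ j ∈ s, φ ⟨g j, hgQ j⟩ := by
    rw [← map_sum]
    congr 1
    apply Subtype.ext
    simp
  rw [← T.p_same hm, e, map_sum, Finset.smul_sum]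
  apply Finset.sum_eq_zero
  intro j _
  by_cases hj : j = i
  · subst hj
    rw [T.p_same (hdeg j _ (hg j)), ← map_smul]
    have : G.emb r • (⟨g j, hgQ j⟩ : Q) = 0 :=
      Subtype.ext (std_killed lam X hX j _ (hg j) r hr)
    rw [this, map_zero]
  · rw [T.p_ne (hdeg j _ (hg j)) hj, smul_zero]

theorem forward (lam : Ideal R) (hlam : lam.IsMaximal) (X : GradedMod G) (hX : IsStdMod G lam X)
    (S T : GradedMod G) (hS : IsSubquotient X S) (hS' : IsSimpleGr S) (hT : IsSubquotient X T)
    (n : ℤ) (hiso : GIso S T n) :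
    Ideal.map ((σ ^ n : R ≃ₐ[ℂ] R)).toAlgHom.toRingHom lam = lam := by
  obtain ⟨f, hf⟩ := hiso
  obtain ⟨m, hm⟩ := hS'.1
  obtain ⟨s, hs⟩ := S.p_sum m
  rw [hs] at hm
  obtain ⟨i, -, hi⟩ := Finset.exists_ne_zero_of_sum_ne_zero hm
  set u := S.p i m with hu
  have hui : u ∈ S.deg i := S.p_mem i m
  let J : Ideal R :=
    { carrier := {r | G.emb r • f.toLin u = 0}
      zero_mem' := by simp
      add_mem' := by
        intro a b ha hb
        have ha' : G.emb a • f.toLin u = 0 := ha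
        have hb' : G.emb b • f.toLin u = 0 := hb
        change G.emb (a + b) • f.toLin u = 0
        rw [map_add, add_smul, ha', hb', add_zero]
      smul_mem' := by
        intro c a ha
        have ha' : G.emb a • f.toLin u = 0 := ha
        change G.emb (c * a) • f.toLin u = 0
        rw [map_mul, mul_smul, ha', smul_zero] }
  have hJ : J ≠ ⊤ := by
    intro h
    have h1 : (1 : R) ∈ J := h ▸ Submodule.mem_top
    have h1' : G.emb 1 • f.toLin u = 0 := h1
    rw [map_one, one_smul] at h1'
    exact hi (hf.1 (by rw [h1', map_zero]))
  have hmax : ∀ k : ℤ, (lam.comap (σ ^ k : R ≃ₐ[ℂ] R)).IsMaximal := fun k =>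
    Ideal.comap_isMaximal_of_surjective _ (σ ^ k : R ≃ₐ[ℂ] R).surjective
  have h1 : lam.comap (σ ^ i : R ≃ₐ[ℂ] R) = J := by
    refine (hmax i).eq_of_le hJ ?_
    intro r hr
    change G.emb r • f.toLin u = 0
    rw [← map_smul, subq_killed lam X hX S hS i u hui r hr, map_zero]
  have h2 : lam.comap (σ ^ (i + n) : R ≃ₐ[ℂ] R) = J := by
    refine (hmax (i + n)).eq_of_le hJ ?_
    intro r hr
    exact subq_killed lam X hX T hT (i + n) _ (f.map_deg i u hui) r hr
  rw [map_eq_iff]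
  intro r
  obtain ⟨r', rfl⟩ := (σ ^ i : R ≃ₐ[ℂ] R).surjective r
  rw [← AlgEquiv.mul_apply, ← zpow_add, add_comm n i]
  have : r' ∈ lam.comap (σ ^ (i + n) : R ≃ₐ[ℂ] R) ↔ r' ∈ lam.comap (σ ^ i : R ≃ₐ[ℂ] R) := by
    rw [h1, h2]
  exact this

theorem backward (lam : Ideal R) (hlam : lam.IsMaximal) (X : GradedMod G) (hX : IsStdMod G lam X)
    (n : ℤ) (h : Ideal.map ((σ ^ n : R ≃ₐ[ℂ] R)).toAlgHom.toRingHom lam = lam) :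
    IsSubquotient X (simpleMod G lam n) := by
  rw [map_eq_iff] at h
  obtain ⟨t, ht, h1, h2⟩ := exists_t G n
  have hX' := hX
  obtain ⟨x, hx, hspan, hann⟩ := hX
  have hy : t • x ∈ X.deg n := by
    have := X.smul_mem ht hx
    rwa [add_zero] at this
  refine simpleMod_subquotient X lam n (t • x) hy ?_
  intro r hr
  by_contra hrl
  obtain ⟨r', l, hl, hrl⟩ := hlam.exists_inv hrl
  apply t_smul_ne lam hlam n t ht h1 h2
  rw [← hann]
  have hk := std_killed lam X hX' n _ hy l ((h l).2 hl)
  have : G.emb (r' * r + l) • t • x = 0 := by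
    rw [map_add, add_smul, map_mul, mul_smul, hr, hk, smul_zero, add_zero]
  rwa [hrl, map_one, one_smul] at this

theorem giso_simple (mu : Ideal R) (n : ℤ) : GIso (simpleMod G mu 0) (simpleMod G mu n) n := by
  refine ⟨⟨LinearMap.id, ?_⟩, Function.bijective_id⟩
  rintro i _ ⟨a, ha, rfl⟩
  refine ⟨a, ?_, rfl⟩
  rw [sub_zero] at ha
  rwa [add_sub_cancel_right]

end Helpers

/-- There exist simple graded subquotients `S, T` of `A^λ` with `S ≅ T[n]`
iff `λ = σⁿ(λ)`; and if `σ` acts freely on maximal ideals then any isomorphism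
`S ≅ T[n]` between simple subquotients of `A^λ` forces `n = 0`, i.e. the simple
subquotients are pairwise nonisomorphic (up to nontrivial shift). -/
theorem stmt4 {R : Type} [CommRing R] [Algebra ℂ R] (hfg : Algebra.FiniteType ℂ R)
    {σ : R ≃ₐ[ℂ] R} {v : R} (G : GWA R σ v)
    (lam : Ideal R) (hlam : lam.IsMaximal)
    (X : GradedMod G) (hX : IsStdMod G lam X) :
    (∀ n : ℤ,
      (∃ S T : GradedMod G,
        (IsSubquotient X S ∧ IsSimpleGr S) ∧ (IsSubquotient X T ∧ IsSimpleGr T) ∧ GIso S T n) ↔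
      Ideal.map ((σ ^ n : R ≃ₐ[ℂ] R)).toAlgHom.toRingHom lam = lam) ∧
    ((∀ (mu : Ideal R), mu.IsMaximal → ∀ n : ℤ, n ≠ 0 →
        Ideal.map ((σ ^ n : R ≃ₐ[ℂ] R)).toAlgHom.toRingHom mu ≠ mu) →
      ∀ S T : GradedMod G, IsSubquotient X S → IsSimpleGr S →
        IsSubquotient X T → IsSimpleGr T → ∀ n : ℤ, GIso S T n → n = 0) := by
  have fwd := forward lam hlam X hX
  refine ⟨fun n => ⟨?_, ?_⟩, ?_⟩
  · rintro ⟨S, T, ⟨hS, hS'⟩, ⟨hT, hT'⟩, hiso⟩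
    exact fwd S T hS hS' hT n hiso
  · intro h
    refine ⟨simpleMod G lam 0, simpleMod G lam n, ⟨?_, simpleMod_simple G lam hlam 0⟩,
      ⟨backward lam hlam X hX n h, simpleMod_simple G lam hlam n⟩, giso_simple lam n⟩
    apply backward lam hlam X hX 0
    rw [map_eq_iff]
    intro r
    simp
  · intro hfree S T hS hS' hT hT' n hiso
    by_contra hn
    exact hfree lam hlam n hn (fwd S T hS hS' hT n hiso)
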